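/- arXiv:2309.05742 — 4 statements merged into one kernel-verified Lean document; each statement's English description precedes it below -/
import Mathlib

section
/- Let σ be holomorphic on a neighborhood of 0 ∈ ℂ. Then there exist r > 0 and a holomorphic function f on the open ball B(0,r) such that f(0) = 0, f'(0) = 1, f' is nonvanishing on B(0,r), and S(f)(z) = −σ(z) for all z ∈ B(0,r). -/
open Complex Metric

/-- The Schwarzian derivative of a holomorphic function `f` at a point `z`:
`S(f)(z) = f'''(z)/f'(z) - (3/2) * (f''(z)/f'(z))^2`. -/
noncomputable def schwarzian (f : ℂ → ℂ) (z : ℂ) : ℂ :=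
  deriv (deriv (deriv f)) z / deriv f z - (3 / 2) * (deriv (deriv f) z / deriv f z) ^ 2

/-- Taylor coefficients at `0` of the solution of `p'' = u p` with `p 0 = a`, `p' 0 = b`, where `q`
is the sequence of Taylor coefficients of `u`. -/
noncomputable def linearODECoeff (q : ℕ → ℂ) (a b : ℂ) : ℕ → ℂ
  | 0 => a
  | 1 => b
  | n + 2 => (∑ k : Fin (n + 1), q k * linearODECoeff q a b (n - k)) / ((n + 2) * (n + 1))

theorem linearODECoeff_add_two (q : ℕ → ℂ) (a b : ℂ) (n : ℕ) :
    (n + 2) * (n + 1) * linearODECoeff q a b (n + 2) =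
      ∑ k ∈ Finset.range (n + 1), q k * linearODECoeff q a b (n - k) := by
  have h1 : (n : ℂ) + 1 ≠ 0 := by exact_mod_cast n.succ_ne_zero
  have h2 : (n : ℂ) + 2 ≠ 0 := by exact_mod_cast (n + 1).succ_ne_zero
  rw [linearODECoeff, mul_div_cancel₀ _ (mul_ne_zero h2 h1), Finset.sum_range]

theorem norm_linearODECoeff_le {q : ℕ → ℂ} {C M : ℝ} (hM : 1 ≤ M) (hCM : C ≤ M ^ 2)
    (hC : 0 ≤ C) (hq : ∀ n, ‖q n‖ ≤ C * M ^ n) (a b : ℂ) (n : ℕ) :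
    ‖linearODECoeff q a b n‖ ≤ (‖a‖ + ‖b‖) * M ^ n := by
  induction n using Nat.strong_induction_on with
  | _ n ih =>
    match n with
    | 0 => simp [linearODECoeff]
    | 1 =>
      rw [linearODECoeff, pow_one]
      nlinarith [norm_nonneg a, norm_nonneg b]
    | n + 2 =>
      set B := ‖a‖ + ‖b‖
      have hB : 0 ≤ B := by positivity
      have hterm : ∀ k ∈ Finset.range (n + 1),
          ‖q k * linearODECoeff q a b (n - k)‖ ≤ C * B * M ^ n := by
        intro k hk
        have hkn : k ≤ n := Nat.lt_succ_iff.mp (Finset.mem_range.mp hk)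
        calc ‖q k * linearODECoeff q a b (n - k)‖
            ≤ (C * M ^ k) * (B * M ^ (n - k)) := by
              rw [norm_mul]
              exact mul_le_mul (hq k) (ih _ (by omega)) (norm_nonneg _) (by positivity)
          _ = C * B * M ^ n := by
              rw [← Nat.add_sub_cancel' hkn, pow_add]
              simp only [add_tsub_cancel_left]
              ring
      have hsum := norm_sum_le_of_le _ hterm
      rw [← linearODECoeff_add_two, Finset.sum_const, Finset.card_range, nsmul_eq_mul, norm_mul,
        norm_mul] at hsum
      have e1 : ‖(n : ℂ) + 1‖ = n + 1 := by exact_mod_cast Complex.norm_natCast (n + 1)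
      have e2 : ‖(n : ℂ) + 2‖ = n + 2 := by exact_mod_cast Complex.norm_natCast (n + 2)
      rw [e1, e2] at hsum
      push_cast at hsum
      have h1 : (0 : ℝ) < n + 1 := by positivity
      have h2 : (n + 2) * ‖linearODECoeff q a b (n + 2)‖ ≤ C * B * M ^ n := by
        refine le_of_mul_le_mul_left ?_ h1
        linarith
      calc ‖linearODECoeff q a b (n + 2)‖
          ≤ (n + 2) * ‖linearODECoeff q a b (n + 2)‖ :=
            le_mul_of_one_le_left (norm_nonneg _) (by linarith)
        _ ≤ C * B * M ^ n := h2
        _ ≤ M ^ 2 * B * M ^ n := by gcongr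
        _ = B * M ^ (n + 2) := by ring

/-- A sequence of geometric growth is the sequence of Taylor coefficients of an analytic
function. -/
theorem exists_analyticAt_iteratedDeriv_eq {c : ℕ → ℂ} {B M : ℝ} (hM : 0 < M)
    (hc : ∀ n, ‖c n‖ ≤ B * M ^ n) :
    ∃ p : ℂ → ℂ, AnalyticAt ℂ p 0 ∧ ∀ n : ℕ, iteratedDeriv n p 0 = n.factorial * c n := by
  have hrad : 0 < (FormalMultilinearSeries.ofScalars ℂ c).radius := by
    refine lt_of_lt_of_le ?_ (FormalMultilinearSeries.le_radius_of_bound _ B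
      (r := M⁻¹.toNNReal) fun n => ?_)
    · simpa using hM
    · rw [FormalMultilinearSeries.ofScalars_norm, Real.coe_toNNReal _ (by positivity), inv_pow, ← div_eq_mul_inv,
        div_le_iff₀ (by positivity)]
      exact hc n
  have hp := (FormalMultilinearSeries.hasFPowerSeriesOnBall _ hrad).hasFPowerSeriesAt
  refine ⟨_, hp.analyticAt, fun n => ?_⟩
  have h := congrArg (fun s => s.coeff n)
    (hp.eq_formalMultilinearSeries hp.analyticAt.hasFPowerSeriesAt)
  simp only [FormalMultilinearSeries.coeff_ofScalars] at h
  have hn : (n.factorial : ℂ) ≠ 0 := by exact_mod_cast n.factorial_ne_zero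
  rw [h, mul_div_cancel₀ _ hn]

theorem AnalyticAt.eventuallyEq_of_iteratedDeriv_eq {f g : ℂ → ℂ} {x : ℂ}
    (hf : AnalyticAt ℂ f x) (hg : AnalyticAt ℂ g x)
    (h : ∀ n, iteratedDeriv n f x = iteratedDeriv n g x) : ∀ᶠ z in nhds x, f z = g z := by
  have hfs := hf.hasFPowerSeriesAt
  simp only [h] at hfs
  have hsub := hfs.sub hg.hasFPowerSeriesAt
  rw [sub_self] at hsub
  filter_upwards [hsub.eventually_eq_zero] with z hz
  exact sub_eq_zero.mp hz

/-- Local solvability of the linear equation `p'' = u p` with analytic coefficient. -/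
theorem exists_analyticAt_deriv_deriv_eq_mul {u : ℂ → ℂ} (hu : AnalyticAt ℂ u 0) (a b : ℂ) :
    ∃ p : ℂ → ℂ, AnalyticAt ℂ p 0 ∧ p 0 = a ∧ deriv p 0 = b ∧
      ∀ᶠ z in nhds 0, deriv (deriv p) z = u z * p z := by
  set q : ℕ → ℂ := fun n => iteratedDeriv n u 0 / n.factorial with hq
  have hqu (n : ℕ) : iteratedDeriv n u 0 = n.factorial * q n := by
    have hn : (n.factorial : ℂ) ≠ 0 := by exact_mod_cast n.factorial_ne_zero
    rw [hq, mul_div_cancel₀ _ hn]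
  obtain ⟨C, A, hC, hA, hbound⟩ :=
    FormalMultilinearSeries.le_mul_pow_of_radius_pos _ hu.hasFPowerSeriesAt.radius_pos
  simp only [FormalMultilinearSeries.ofScalars_norm] at hbound
  set M : ℝ := 1 + A + C
  obtain ⟨p, hp, hpc⟩ := exists_analyticAt_iteratedDeriv_eq (M := M) (by positivity)
    (norm_linearODECoeff_le (q := q) (C := C) (M := M) (by linarith) (by nlinarith) hC.le
      (fun n => (hbound n).trans (by gcongr; linarith)) a b)
  refine ⟨p, hp, by simpa [linearODECoeff] using hpc 0, by simpa [linearODECoeff] using hpc 1,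
    hp.deriv.deriv.eventuallyEq_of_iteratedDeriv_eq (hu.mul hp) fun n => ?_⟩
  change _ = iteratedDeriv n (u * p) 0
  rw [← iteratedDeriv_succ', ← iteratedDeriv_succ', hpc,
    iteratedDeriv_mul hu.contDiffAt hp.contDiffAt]
  have hfac : (((n + 1 + 1).factorial : ℕ) : ℂ) = n.factorial * ((n + 2) * (n + 1)) := by
    simp only [Nat.factorial_succ]
    push_cast
    ring
  rw [hfac, mul_assoc, linearODECoeff_add_two, Finset.mul_sum]
  refine Finset.sum_congr rfl fun k hk => ?_
  have hkn : k ≤ n := Nat.lt_succ_iff.mp (Finset.mem_range.mp hk)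
  rw [hqu, hpc, ← Nat.choose_mul_factorial_mul_factorial hkn]
  push_cast
  ring

/-- If `p'' = u p` and `f' = p⁻²` near `z`, then `S(f)(z) = -2 u(z)`. -/
theorem schwarzian_of_deriv_eq_inv_sq {f p : ℂ → ℂ} {z u : ℂ} (hp : AnalyticAt ℂ p z)
    (hpz : p z ≠ 0) (hu : deriv (deriv p) z = u * p z)
    (hf : ∀ᶠ w in nhds z, deriv f w = (p w ^ 2)⁻¹) :
    schwarzian f z = -(2 * u) := by
  have hf2 : ∀ᶠ w in nhds z, deriv (deriv f) w = -(2 * deriv p w) / p w ^ 3 := by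
    filter_upwards [hf.eventually_nhds, hp.eventually_analyticAt,
      hp.continuousAt.eventually_ne hpz] with w hfw hpw hw
    rw [Filter.EventuallyEq.deriv_eq hfw]
    have h := (hpw.differentiableAt.hasDerivAt.pow 2).inv (pow_ne_zero 2 hw)
    refine h.deriv.trans ?_
    simp
    field_simp
  have hf3 : deriv (deriv (deriv f)) z =
      (-(2 * (u * p z)) * p z ^ 3 + 2 * deriv p z * (3 * p z ^ 2 * deriv p z)) /
        (p z ^ 3) ^ 2 := by
    rw [Filter.EventuallyEq.deriv_eq hf2]
    have h := ((hp.deriv.differentiableAt.hasDerivAt.const_mul 2).neg).div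
      (hp.differentiableAt.hasDerivAt.pow 3) (pow_ne_zero 3 hpz)
    refine h.deriv.trans ?_
    simp [hu]
  rw [schwarzian, hf3, hf2.self_of_nhds, hf.self_of_nhds]
  field_simp
  ring

/-- Local solvability of the Schwarzian equation `S(f) = -σ` near `0`, with normalization
`f(0) = 0`, `f'(0) = 1` and `f'` nonvanishing. -/
theorem schwarzian_local_solvability
    (σ : ℂ → ℂ) (hσ : AnalyticAt ℂ σ 0) :
    ∃ r : ℝ, 0 < r ∧ ∃ f : ℂ → ℂ,
      DifferentiableOn ℂ f (ball (0 : ℂ) r) ∧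
      f 0 = 0 ∧ deriv f 0 = 1 ∧
      ∀ z ∈ ball (0 : ℂ) r, deriv f z ≠ 0 ∧ schwarzian f z = -σ z := by
  obtain ⟨p, hp, hp0, -, hode⟩ :=
    exists_analyticAt_deriv_deriv_eq_mul (u := fun z => σ z / 2) (by fun_prop) 1 0
  have hne : ∀ᶠ z in nhds 0, p z ≠ 0 := hp.continuousAt.eventually_ne (by simp [hp0])
  obtain ⟨r, hr, hball⟩ := Metric.eventually_nhds_iff_ball.mp
    (hp.eventually_analyticAt.and (hne.and hode))
  have hdiff : DifferentiableOn ℂ (fun z => (p z ^ 2)⁻¹) (ball 0 r) := fun z hz =>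
    (((hball z hz).1.differentiableAt.pow 2).inv
      (pow_ne_zero 2 (hball z hz).2.1)).differentiableWithinAt
  obtain ⟨f, hf0, hf⟩ := hdiff.isExactOn_ball.with_val_at 0 0
  refine ⟨r, hr, f, fun z hz => (hf z hz).differentiableAt.differentiableWithinAt, hf0, ?_,
    fun z hz => ?_⟩
  · simp [(hf 0 (mem_ball_self hr)).deriv, hp0]
  · obtain ⟨hpz, hpne, hpode⟩ := hball z hz
    refine ⟨by simpa [(hf z hz).deriv] using hpne, ?_⟩
    rw [schwarzian_of_deriv_eq_inv_sq hpz hpne hpode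
      (by filter_upwards [isOpen_ball.mem_nhds hz] with w hw using (hf w hw).deriv)]
    ring
end

section
/- Let μ ∈ ℝ with μ > −1/2 and μ ≠ 0. For z ∈ ℂ∖(−∞,0] define, using principal complex powers, the matrix F(z) = (2μ+1)^{−1/2}·[[(μ+1)·z^μ, μ·z^{−(μ+1)}],[μ·z^{μ+1}, (μ+1)·z^{−μ}]]. Then each entry of F is holomorphic on ℂ∖(−∞,0], det F(z) = 1 for all z, the entrywise derivative satisfies F(z)⁻¹·F'(z) = (μ(μ+1)/(2μ+1))·[[z^{−1}, −z^{−2μ−2}],[z^{2μ}, −z^{−1}]], and det(F(z)⁻¹·F'(z)) = 0 for all z ∈ ℂ∖(−∞,0]. -/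
open Complex Matrix

/-- On the slit plane, `w ↦ a * (b * w ^ c)` has derivative `a * (b * (c * (z ^ c / z)))`. -/
theorem hasDerivAt_const_mul_const_mul_cpow (a b c : ℂ) {z : ℂ} (hz : z ∈ slitPlane) :
    HasDerivAt (fun w : ℂ => a * (b * w ^ c)) (a * (b * (c * (z ^ c / z)))) z := by
  have h := (((hasStrictDerivAt_cpow_const (c := c) hz).hasDerivAt.const_mul b).const_mul a)
  rwa [cpow_sub _ _ (slitPlane_ne_zero hz), cpow_one] at h

/-- Bryant's catenoid-cousin family `F` is holomorphic on the slit plane, takes values in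
`SL₂ℂ`, and its Darboux derivative `F⁻¹F'` is the displayed nilpotent-determinant matrix,
so `F` is a null curve. -/
theorem catenoid_cousin_null
    (μ : ℝ) (hμ : -1/2 < μ) (hμ0 : μ ≠ 0)
    (F : ℂ → Matrix (Fin 2) (Fin 2) ℂ)
    (hF : ∀ z : ℂ, F z = ((Real.sqrt (2 * μ + 1) : ℂ))⁻¹ •
      !![((μ : ℂ) + 1) * z ^ (μ : ℂ), (μ : ℂ) * z ^ (-((μ : ℂ) + 1));
         (μ : ℂ) * z ^ ((μ : ℂ) + 1), ((μ : ℂ) + 1) * z ^ (-(μ : ℂ))]) :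
    (∀ i j : Fin 2, DifferentiableOn ℂ (fun z => F z i j) Complex.slitPlane) ∧
    (∀ z ∈ Complex.slitPlane, (F z).det = 1) ∧
    (∀ z ∈ Complex.slitPlane,
      (F z)⁻¹ * (Matrix.of fun i j => deriv (fun w => F w i j) z) =
        ((μ : ℂ) * ((μ : ℂ) + 1) / (2 * (μ : ℂ) + 1)) •
          !![z ^ (-1 : ℂ), -z ^ (-2 * (μ : ℂ) - 2);
             z ^ (2 * (μ : ℂ)), -z ^ (-1 : ℂ)]) ∧
    (∀ z ∈ Complex.slitPlane,
      ((F z)⁻¹ * (Matrix.of fun i j => deriv (fun w => F w i j) z)).det = 0) := by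
  set s : ℂ := (Real.sqrt (2 * μ + 1) : ℂ) with hs
  have hpos : 0 < 2 * μ + 1 := by linarith
  have hs2 : s * s = 2 * (μ : ℂ) + 1 := by
    rw [hs, ← ofReal_mul, Real.mul_self_sqrt hpos.le]
    push_cast
    ring
  have hne : 2 * (μ : ℂ) + 1 ≠ 0 := by exact_mod_cast hpos.ne'
  have hs0 : s ≠ 0 := by
    rintro h
    rw [h, zero_mul] at hs2
    exact hne hs2.symm
  have hdet : ∀ z ∈ slitPlane, (F z).det = 1 := by
    intro z hz
    have hz0 := slitPlane_ne_zero hz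
    have ha : z ^ (μ : ℂ) ≠ 0 := by simp [cpow_eq_zero_iff, hz0]
    rw [hF, det_fin_two]
    simp only [Matrix.smul_apply, of_apply, cons_val', cons_val_zero, cons_val_one, cons_val_fin_one,
      smul_eq_mul, cpow_neg, cpow_add _ _ hz0, cpow_one]
    field_simp
    linear_combination -hs2
  have hasDeriv : ∀ z ∈ slitPlane, ∀ i j : Fin 2, HasDerivAt (fun w => F w i j)
      ((s⁻¹ • !![((μ : ℂ) + 1) * (μ * (z ^ (μ : ℂ) / z)),
          μ * (-((μ : ℂ) + 1) * (z ^ (-((μ : ℂ) + 1)) / z));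
          μ * (((μ : ℂ) + 1) * (z ^ ((μ : ℂ) + 1) / z)),
          ((μ : ℂ) + 1) * (-μ * (z ^ (-(μ : ℂ)) / z))] : Matrix (Fin 2) (Fin 2) ℂ) i j) z := by
    intro z hz i j
    simp only [hF]
    fin_cases i <;> fin_cases j <;>
      exact hasDerivAt_const_mul_const_mul_cpow _ _ _ hz
  have hderiv : ∀ z ∈ slitPlane,
      (F z)⁻¹ * (Matrix.of fun i j => deriv (fun w => F w i j) z) =
        ((μ : ℂ) * ((μ : ℂ) + 1) / (2 * (μ : ℂ) + 1)) •
          !![z ^ (-1 : ℂ), -z ^ (-2 * (μ : ℂ) - 2);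
             z ^ (2 * (μ : ℂ)), -z ^ (-1 : ℂ)] := by
    intro z hz
    have hz0 := slitPlane_ne_zero hz
    have ha : z ^ (μ : ℂ) ≠ 0 := by simp [cpow_eq_zero_iff, hz0]
    have hsq : z ^ (2 * (μ : ℂ)) = z ^ (μ : ℂ) * z ^ (μ : ℂ) := by
      rw [two_mul, cpow_add _ _ hz0]
    have hinv : z ^ (-2 * (μ : ℂ) - 2) = (z ^ (μ : ℂ) * z ^ (μ : ℂ) * (z * z))⁻¹ := by
      rw [show -2 * (μ : ℂ) - 2 = -(μ + μ + (1 + 1)) by ring, cpow_neg]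
      simp only [cpow_add _ _ hz0, cpow_one]
    simp only [(hasDeriv z hz _ _).deriv]
    rw [Matrix.inv_def, hdet z hz, Ring.inverse_one, one_smul, hF z, adjugate_smul,
      adjugate_fin_two_of, hsq, hinv, ← hs2]
    ext i j
    fin_cases i <;> fin_cases j <;>
    · simp [Matrix.mul_apply, Fin.sum_univ_two, -mul_eq_mul_left_iff, cpow_neg,
        cpow_add _ _ hz0]
      field_simp
      ring
  refine ⟨?_, hdet, hderiv, ?_⟩
  · intro i j z hz
    exact (hasDeriv z hz i j).differentiableAt.differentiableWithinAt
  · intro z hz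
    have hz0 := slitPlane_ne_zero hz
    have hmul : z ^ (-2 * (μ : ℂ) - 2) * z ^ (2 * (μ : ℂ)) = z ^ (-1 : ℂ) * z ^ (-1 : ℂ) := by
      rw [← cpow_add _ _ hz0, ← cpow_add _ _ hz0]
      ring_nf
    rw [hderiv z hz, det_smul, det_fin_two_of]
    linear_combination
      ((μ : ℂ) * ((μ : ℂ) + 1) / (2 * (μ : ℂ) + 1)) ^ Fintype.card (Fin 2) * hmul
end

section
/- Let U ⊆ ℂ be open and let f, g, s : U → ℂ be holomorphic with g' nonvanishing on U, s nonvanishing on U, and s² = f'/g' on U. Define D = (1/g')·(f'/g')' and R = (S(f) − S(g))/g', and define holomorphic functions α = s − (f/2)·s⁻³·D, β = f·(s⁻¹ + (g/2)·s⁻³·D) − g·s, γ = −(1/2)·s⁻³·D, δ = s⁻¹ + (g/2)·s⁻³·D, and the matrix-valued function ω = [[α, β],[γ, δ]]. Then for every z ∈ U the entrywise derivative of ω satisfies ω'(z) = −(1/2)·R(z)·s(z)⁻¹·[[f(z), −f(z)·g(z)],[1, −g(z)]]. -/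
open Complex Matrix

/-- On an open set where `f' = s² g'`, the difference of the Schwarzians of `f` and `g` in terms of
the derivatives of `s` and `g`. -/
theorem schwarzian_sub_schwarzian_of_deriv_eq_sq_mul {U : Set ℂ} (hU : IsOpen U) {f g s : ℂ → ℂ}
    (hg : DifferentiableOn ℂ g U) (hs : DifferentiableOn ℂ s U)
    (hf' : ∀ z ∈ U, deriv f z = s z ^ 2 * deriv g z) {z : ℂ} (hz : z ∈ U)
    (hg' : deriv g z ≠ 0) (hs0 : s z ≠ 0) :
    schwarzian f z - schwarzian g z =
      2 * deriv (deriv s) z / s z - 4 * (deriv s z / s z) ^ 2 -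
        2 * (deriv s z / s z) * (deriv (deriv g) z / deriv g z) := by
  have deriv_at {h : ℂ → ℂ} (hh : DifferentiableOn ℂ h U) {w : ℂ} (hw : w ∈ U) :
      HasDerivAt h (deriv h w) w := (hh.differentiableAt (hU.mem_nhds hw)).hasDerivAt
  have hf₂ : ∀ w ∈ U, deriv (deriv f) w =
      2 * s w * deriv s w * deriv g w + s w ^ 2 * deriv (deriv g) w := by
    intro w hw
    rw [(Filter.eventuallyEq_of_mem (hU.mem_nhds hw) hf').deriv_eq,
      (((deriv_at hs hw).fun_pow 2).fun_mul (deriv_at (hg.deriv hU) hw)).deriv]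
    norm_num
  have hf₃ : deriv (deriv (deriv f)) z =
      2 * deriv s z ^ 2 * deriv g z + 2 * s z * deriv (deriv s) z * deriv g z +
        4 * s z * deriv s z * deriv (deriv g) z + s z ^ 2 * deriv (deriv (deriv g)) z := by
    rw [(Filter.eventuallyEq_of_mem (hU.mem_nhds hz) hf₂).deriv_eq,
      (((((deriv_at hs hz).const_mul 2).fun_mul (deriv_at (hs.deriv hU) hz)).fun_mul
        (deriv_at (hg.deriv hU) hz)).fun_add (((deriv_at hs hz).fun_pow 2).fun_mul
          (deriv_at ((hg.deriv hU).deriv hU) hz))).deriv]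
    norm_num
    ring
  rw [schwarzian, schwarzian, hf₃, hf₂ z hz, hf' z hz]
  field_simp
  ring

/-- Small's formula for the derivative of the null lift `ω` of the Bryant surface with
hyperbolic Gauss map `f` and secondary Gauss map `g`:
`dω = -(1/2)·R·s⁻¹·[[f, -fg],[1, -g]]`. -/
theorem small_null_lift_deriv
    (U : Set ℂ) (hU : IsOpen U) (f g s : ℂ → ℂ)
    (hf : DifferentiableOn ℂ f U) (hg : DifferentiableOn ℂ g U)
    (hs : DifferentiableOn ℂ s U)
    (hg' : ∀ z ∈ U, deriv g z ≠ 0) (hs0 : ∀ z ∈ U, s z ≠ 0)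
    (hsq : ∀ z ∈ U, s z ^ 2 = deriv f z / deriv g z)
    (D R α β γ δ : ℂ → ℂ) (ω : ℂ → Matrix (Fin 2) (Fin 2) ℂ)
    (hD : D = fun z => (deriv g z)⁻¹ * deriv (fun w => deriv f w / deriv g w) z)
    (hR : R = fun z => (schwarzian f z - schwarzian g z) / deriv g z)
    (hα : α = fun z => s z - (f z / 2) * (s z ^ 3)⁻¹ * D z)
    (hβ : β = fun z => f z * ((s z)⁻¹ + (g z / 2) * (s z ^ 3)⁻¹ * D z) - g z * s z)
    (hγ : γ = fun z => -(1 / 2) * (s z ^ 3)⁻¹ * D z)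
    (hδ : δ = fun z => (s z)⁻¹ + (g z / 2) * (s z ^ 3)⁻¹ * D z)
    (hω : ω = fun z => !![α z, β z; γ z, δ z]) :
    ∀ z ∈ U,
      (Matrix.of fun i j => deriv (fun w => ω w i j) z) =
        (-(1 / 2) * R z * (s z)⁻¹) • !![f z, -(f z * g z); 1, -g z] := by
  have deriv_at {h : ℂ → ℂ} (hh : DifferentiableOn ℂ h U) {w : ℂ} (hw : w ∈ U) :
      HasDerivAt h (deriv h w) w := (hh.differentiableAt (hU.mem_nhds hw)).hasDerivAt
  have hf' : ∀ w ∈ U, deriv f w = s w ^ 2 * deriv g w := fun w hw => by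
    rw [hsq w hw, div_mul_cancel₀ _ (hg' w hw)]
  have hDU : ∀ w ∈ U, D w = 2 * s w * deriv s w / deriv g w := by
    intro w hw
    have h : (fun w => deriv f w / deriv g w) =ᶠ[nhds w] fun w => s w ^ 2 :=
      Filter.eventuallyEq_of_mem (hU.mem_nhds hw) fun x hx => (hsq x hx).symm
    simp only [hD]
    rw [h.deriv_eq, ((deriv_at hs hw).fun_pow 2).deriv]
    norm_num
    ring
  have hγU : ∀ w ∈ U, γ w = -(deriv s w / (s w ^ 2 * deriv g w)) := by
    intro w hw
    have h₁ := hs0 w hw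
    have h₂ := hg' w hw
    simp only [hγ]
    rw [hDU w hw]
    field_simp
  have hαγ : α = fun w => s w + f w * γ w := by
    funext w
    simp only [hα, hγ]
    ring
  have hδγ : δ = fun w => (s w)⁻¹ - g w * γ w := by
    funext w
    simp only [hδ, hγ]
    ring
  have hβδ : β = fun w => f w * δ w - g w * s w := by
    simp only [hβ, hδ]
  intro z hz
  have hsz := hs0 z hz
  have hgz := hg' z hz
  have dγ : HasDerivAt γ (-(1 / 2) * R z * (s z)⁻¹) z := by
    have h := ((deriv_at (hs.deriv hU) hz).fun_div (((deriv_at hs hz).fun_pow 2).fun_mul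
      (deriv_at (hg.deriv hU) hz)) (mul_ne_zero (pow_ne_zero 2 hsz) hgz)).fun_neg
    refine (h.congr_of_eventuallyEq
      (Filter.eventuallyEq_of_mem (hU.mem_nhds hz) hγU)).congr_deriv ?_
    simp only [hR]
    rw [schwarzian_sub_schwarzian_of_deriv_eq_sq_mul hU hg hs hf' hz hgz hsz]
    norm_num
    field_simp
    ring
  have dα : HasDerivAt α (-(1 / 2) * R z * (s z)⁻¹ * f z) z := by
    rw [hαγ]
    refine ((deriv_at hs hz).fun_add ((deriv_at hf hz).fun_mul dγ)).congr_deriv ?_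
    rw [hγU z hz, hf' z hz]
    field_simp
    ring
  have dδ : HasDerivAt δ (-(1 / 2) * R z * (s z)⁻¹ * -g z) z := by
    rw [hδγ]
    refine (((deriv_at hs hz).fun_inv hsz).fun_sub
      ((deriv_at hg hz).fun_mul dγ)).congr_deriv ?_
    rw [hγU z hz]
    field_simp
    ring
  have dβ : HasDerivAt β (-(1 / 2) * R z * (s z)⁻¹ * -(f z * g z)) z := by
    rw [hβδ]
    refine (((deriv_at hf hz).fun_mul dδ).fun_sub
      ((deriv_at hg hz).fun_mul (deriv_at hs hz))).congr_deriv ?_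
    simp only [hδγ]
    rw [hγU z hz, hf' z hz]
    field_simp
    ring
  ext i j
  fin_cases i <;> fin_cases j
  · simpa [hω] using dα.deriv
  · simpa [hω] using dβ.deriv
  · simpa [hω] using dγ.deriv
  · simpa [hω] using dδ.deriv
end

section
/- Let U ⊆ ℂ be open and let f, g, s : U → ℂ be holomorphic with g' nonvanishing on U, s nonvanishing on U, and s² = f'/g' on U. Define D = (1/g')·(f'/g')' and R = (S(f) − S(g))/g', and define holomorphic functions α = s − (f/2)·s⁻³·D, β = f·(s⁻¹ + (g/2)·s⁻³·D) − g·s, γ = −(1/2)·s⁻³·D, δ = s⁻¹ + (g/2)·s⁻³·D, and the matrix-valued function ω = [[α, β],[γ, δ]]. Then for every z ∈ U: det ω(z) = α(z)·δ(z) − β(z)·γ(z) = 1, the entrywise derivative satisfies ω(z)⁻¹·ω'(z) = −(1/2)·R(z)·[[g(z), −g(z)²],[1, −g(z)]], and consequently det(ω(z)⁻¹·ω'(z)) = 0, i.e. ω is a null holomorphic curve in SL₂ℂ. -/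
open Complex Matrix

/-- If `deriv f = s² * deriv g` on an open set, then the difference of the Schwarzians of `f`
and `g` is expressed through `s` and `g`. -/
theorem schwarzian_sub_of_deriv_eq {U : Set ℂ} (hU : IsOpen U) {f g s : ℂ → ℂ}
    (hg : DifferentiableOn ℂ g U) (hs : DifferentiableOn ℂ s U)
    (hg' : ∀ z ∈ U, deriv g z ≠ 0) (hs0 : ∀ z ∈ U, s z ≠ 0)
    (hfs : ∀ z ∈ U, deriv f z = s z ^ 2 * deriv g z) {z : ℂ} (hz : z ∈ U) :
    schwarzian f z - schwarzian g z =
      2 * (deriv (deriv s) z / s z - 2 * (deriv s z / s z) ^ 2 -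
        deriv s z / s z * (deriv (deriv g) z / deriv g z)) := by
  have hasDeriv {h : ℂ → ℂ} (hh : DifferentiableOn ℂ h U) (w : ℂ) (hw : w ∈ U) :
      HasDerivAt h (deriv h w) w :=
    (hh.differentiableAt (hU.mem_nhds hw)).hasDerivAt
  have hs' := hs.deriv hU
  have hdg := hg.deriv hU
  have hddg := hdg.deriv hU
  have second (w : ℂ) (hw : w ∈ U) : deriv (deriv f) w =
      2 * s w * deriv s w * deriv g w + s w ^ 2 * deriv (deriv g) w := by
    have heq : deriv f =ᶠ[nhds w] fun v => s v ^ 2 * deriv g v :=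
      Filter.eventually_of_mem (hU.mem_nhds hw) hfs
    rw [heq.deriv_eq]
    refine (((hasDeriv hs w hw).pow 2).mul (hasDeriv hdg w hw)).deriv.trans ?_
    simp
  have third : deriv (deriv (deriv f)) z =
      2 * deriv s z ^ 2 * deriv g z + 2 * s z * deriv (deriv s) z * deriv g z +
        4 * s z * deriv s z * deriv (deriv g) z + s z ^ 2 * deriv (deriv (deriv g)) z := by
    have heq : deriv (deriv f) =ᶠ[nhds z] fun w =>
        2 * s w * deriv s w * deriv g w + s w ^ 2 * deriv (deriv g) w :=
      Filter.eventually_of_mem (hU.mem_nhds hz) second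
    rw [heq.deriv_eq]
    refine (((((hasDeriv hs z hz).const_mul 2).mul (hasDeriv hs' z hz)).mul
      (hasDeriv hdg z hz)).add
      (((hasDeriv hs z hz).pow 2).mul (hasDeriv hddg z hz))).deriv.trans ?_
    simp
    ring
  have hg0 := hg' z hz
  have hsz := hs0 z hz
  rw [schwarzian, schwarzian, third, second z hz, hfs z hz]
  field_simp
  ring

/-- Small's null lift `ω` of the Bryant surface with hyperbolic Gauss map `f` and secondary
Gauss map `g` takes values in `SL₂ℂ`, satisfies
`ω⁻¹ dω = -(1/2)·R·[[g, -g²],[1, -g]]`, and is a null holomorphic curve: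
`det(ω⁻¹ ω') = 0`. -/
theorem small_null_lift_is_null
    (U : Set ℂ) (hU : IsOpen U) (f g s : ℂ → ℂ)
    (hf : DifferentiableOn ℂ f U) (hg : DifferentiableOn ℂ g U)
    (hs : DifferentiableOn ℂ s U)
    (hg' : ∀ z ∈ U, deriv g z ≠ 0) (hs0 : ∀ z ∈ U, s z ≠ 0)
    (hsq : ∀ z ∈ U, s z ^ 2 = deriv f z / deriv g z)
    (D R α β γ δ : ℂ → ℂ) (ω : ℂ → Matrix (Fin 2) (Fin 2) ℂ)
    (hD : D = fun z => (deriv g z)⁻¹ * deriv (fun w => deriv f w / deriv g w) z)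
    (hR : R = fun z => (schwarzian f z - schwarzian g z) / deriv g z)
    (hα : α = fun z => s z - (f z / 2) * (s z ^ 3)⁻¹ * D z)
    (hβ : β = fun z => f z * ((s z)⁻¹ + (g z / 2) * (s z ^ 3)⁻¹ * D z) - g z * s z)
    (hγ : γ = fun z => -(1 / 2) * (s z ^ 3)⁻¹ * D z)
    (hδ : δ = fun z => (s z)⁻¹ + (g z / 2) * (s z ^ 3)⁻¹ * D z)
    (hω : ω = fun z => !![α z, β z; γ z, δ z]) :
    ∀ z ∈ U,
      ((ω z).det = 1 ∧ α z * δ z - β z * γ z = 1) ∧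
      (ω z)⁻¹ * (Matrix.of fun i j => deriv (fun w => ω w i j) z) =
        (-(1 / 2) * R z) • !![g z, -(g z) ^ 2; 1, -g z] ∧
      ((ω z)⁻¹ * (Matrix.of fun i j => deriv (fun w => ω w i j) z)).det = 0 := by
  intro z hz
  have hasDeriv {h : ℂ → ℂ} (hh : DifferentiableOn ℂ h U) (w : ℂ) (hw : w ∈ U) :
      HasDerivAt h (deriv h w) w :=
    (hh.differentiableAt (hU.mem_nhds hw)).hasDerivAt
  have hfs (w : ℂ) (hw : w ∈ U) : deriv f w = s w ^ 2 * deriv g w := by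
    rw [hsq w hw, div_mul_cancel₀ _ (hg' w hw)]
  let p : ℂ → ℂ := fun w => deriv s w / (s w ^ 2 * deriv g w)
  have hDp (w : ℂ) (hw : w ∈ U) : (s w ^ 3)⁻¹ * D w = 2 * p w := by
    have heq : (fun v => deriv f v / deriv g v) =ᶠ[nhds w] fun v => s v ^ 2 :=
      Filter.eventually_of_mem (hU.mem_nhds hw) fun v hv => (hsq v hv).symm
    have hderiv : deriv (fun v => s v ^ 2) w = 2 * s w * deriv s w :=
      ((hasDeriv hs w hw).pow 2).deriv.trans (by simp)
    have hg0 := hg' w hw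
    have hsw := hs0 w hw
    simp only [hD, p, heq.deriv_eq, hderiv]
    field_simp
  have hg0 := hg' z hz
  have hsz := hs0 z hz
  obtain ⟨p', hp, hpR⟩ : ∃ p', HasDerivAt p p' z ∧ s z * p' = 1 / 2 * R z := by
    refine ⟨_, (hasDeriv (hs.deriv hU) z hz).div
      (((hasDeriv hs z hz).pow 2).mul (hasDeriv (hg.deriv hU) z hz))
      (mul_ne_zero (pow_ne_zero 2 hsz) hg0), ?_⟩
    simp only [hR, schwarzian_sub_of_deriv_eq hU hg hs hg' hs0 hfs hz, Pi.pow_apply]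
    field_simp
    simp
    ring
  have hαp (w : ℂ) (hw : w ∈ U) : α w = s w - f w * p w := by
    simp only [hα]; linear_combination (-f w / 2) * hDp w hw
  have hδp (w : ℂ) (hw : w ∈ U) : δ w = (s w)⁻¹ + g w * p w := by
    simp only [hδ]; linear_combination (g w / 2) * hDp w hw
  have hγp (w : ℂ) (hw : w ∈ U) : γ w = -p w := by
    simp only [hγ]; linear_combination (-1 / 2) * hDp w hw
  have hβp (w : ℂ) (hw : w ∈ U) : β w = f w * ((s w)⁻¹ + g w * p w) - g w * s w := by
    simp only [hβ]; linear_combination (f w * g w / 2) * hDp w hw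
  have derivOf {h k : ℂ → ℂ} {k' c : ℂ} (hhk : ∀ w ∈ U, h w = k w)
      (hk : HasDerivAt k k' z) (hc : k' = c) : deriv h z = c := by
    have heq : h =ᶠ[nhds z] k := Filter.eventually_of_mem (hU.mem_nhds hz) hhk
    rw [heq.deriv_eq, hk.deriv, hc]
  have hF := hasDeriv hf z hz
  have hG := hasDeriv hg z hz
  have hS := hasDeriv hs z hz
  have hpz : p z * (s z ^ 2 * deriv g z) = deriv s z :=
    div_mul_cancel₀ _ (mul_ne_zero (pow_ne_zero 2 hsz) hg0)
  have hα' : deriv α z = -f z * p' := derivOf hαp (hS.sub (hF.mul hp)) <| by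
    rw [hfs z hz, ← hpz]; ring
  have hγ' : deriv γ z = -p' := derivOf hγp hp.neg rfl
  have hδ' : deriv δ z = g z * p' := derivOf hδp ((hS.inv hsz).add (hG.mul hp)) <| by
    rw [← hpz]; field_simp; ring
  have hβ' : deriv β z = f z * g z * p' :=
    derivOf hβp ((hF.mul ((hS.inv hsz).add (hG.mul hp))).sub (hG.mul hS)) <| by
      simp only [Pi.add_apply, Pi.mul_apply, Pi.inv_apply]
      rw [hfs z hz, ← hpz]; field_simp; ring
  have hdet : α z * δ z - β z * γ z = 1 := by
    rw [hαp z hz, hβp z hz, hγp z hz, hδp z hz]; field_simp; ring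
  have hωz : ω z = !![α z, β z; γ z, δ z] := by rw [hω]
  have hωdet : (ω z).det = 1 := by rw [hωz, det_fin_two_of, hdet]
  have hω' : (Matrix.of fun i j => deriv (fun w => ω w i j) z) =
      !![-f z * p', f z * g z * p'; -p', g z * p'] := by
    ext i j
    fin_cases i <;> fin_cases j <;> simp [hω, hα', hβ', hγ', hδ']
  have hmain : (ω z)⁻¹ * (Matrix.of fun i j => deriv (fun w => ω w i j) z) =
      (-(1 / 2) * R z) • !![g z, -(g z) ^ 2; 1, -g z] := by
    have hRp : -(1 / 2) * R z = -(s z * p') := by rw [hpR]; ring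
    rw [hω', Matrix.inv_def, hωdet, hωz, adjugate_fin_two_of, hRp, hαp z hz, hβp z hz, hγp z hz,
      hδp z hz]
    ext i j
    fin_cases i <;> fin_cases j <;> simp [Matrix.mul_apply, Fin.sum_univ_two] <;> ring
  refine ⟨⟨hωdet, hdet⟩, hmain, ?_⟩
  rw [hmain, det_smul, det_fin_two_of]
  ring
end
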